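/- Let N > 0 be a natural number, K ≥ 0, and V : ℝⁿ → ℝⁿ a smooth vector field satisfying ½⟨(DV(x) + DV(x)ᵀ)ξ, ξ⟩ + (1/N)⟨V(x), ξ⟩² ≤ K|ξ|² for all x, ξ ∈ ℝⁿ. Let a < 0 and b < 0 be real constants with a ≤ −K. If u : ℝⁿ → ℝ is a smooth positive solution of the elliptic equation Δu + ⟨V, ∇u⟩ + a·u·log u + b·u = 0 with u ≤ 1, then u is identically equal to the constant e^{−b/a}. -/

import Mathlib

open scoped RealInnerProductSpace ContDiff

/-- The Euclidean Laplacian of `f : ℝⁿ → ℝ` at `x`, i.e. the sum of its second partial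
derivatives (the trace of its Hessian). -/
noncomputable def lap {n : ℕ} (f : EuclideanSpace ℝ (Fin n) → ℝ)
    (x : EuclideanSpace ℝ (Fin n)) : ℝ :=
  ∑ i : Fin n, fderiv ℝ (fun y => fderiv ℝ f y (EuclideanSpace.single i 1)) x
    (EuclideanSpace.single i 1)


section Auxiliary

variable {n : ℕ}

/-- The `i`-th partial derivative of `f`. -/
noncomputable def pderiv (i : Fin n) (f : EuclideanSpace ℝ (Fin n) → ℝ)
    (x : EuclideanSpace ℝ (Fin n)) : ℝ :=
  fderiv ℝ f x (EuclideanSpace.single i 1)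

/-- The drift Laplacian `Δf + ⟨V, ∇f⟩`, in coordinates. -/
noncomputable def driftLap (V : EuclideanSpace ℝ (Fin n) → EuclideanSpace ℝ (Fin n))
    (f : EuclideanSpace ℝ (Fin n) → ℝ) (x : EuclideanSpace ℝ (Fin n)) : ℝ :=
  ∑ i, (pderiv i (pderiv i f) x + V x i * pderiv i f x)

/-- The squared norm of the gradient, in coordinates. -/
noncomputable def gradSq (f : EuclideanSpace ℝ (Fin n) → ℝ)
    (x : EuclideanSpace ℝ (Fin n)) : ℝ :=
  ∑ i, pderiv i f x ^ 2

variable {f g : EuclideanSpace ℝ (Fin n) → ℝ} {x : EuclideanSpace ℝ (Fin n)} {i : Fin n}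

lemma gradSq_nonneg : 0 ≤ gradSq f x := Finset.sum_nonneg fun _ _ => sq_nonneg _

lemma ContDiff.pderiv (hf : ContDiff ℝ ∞ f) (i : Fin n) : ContDiff ℝ ∞ (pderiv i f) := by
  have h : ContDiff ℝ ∞ (fderiv ℝ f) := hf.fderiv_right (by simp)
  exact h.clm_apply contDiff_const

lemma ContDiff.gradSq (hf : ContDiff ℝ ∞ f) : ContDiff ℝ ∞ (gradSq f) :=
  ContDiff.sum fun i _ => (hf.pderiv i).pow 2

lemma ContDiff.differentiableAt_of_infty (hf : ContDiff ℝ ∞ f) : DifferentiableAt ℝ f x :=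
  (hf.differentiable (by simp)) x

lemma pderiv_add (hf : DifferentiableAt ℝ f x) (hg : DifferentiableAt ℝ g x) :
    pderiv i (fun y => f y + g y) x = pderiv i f x + pderiv i g x := by
  simp only [pderiv]
  rw [fderiv_fun_add hf hg]
  rfl

lemma pderiv_sub (hf : DifferentiableAt ℝ f x) (hg : DifferentiableAt ℝ g x) :
    pderiv i (fun y => f y - g y) x = pderiv i f x - pderiv i g x := by
  simp only [pderiv]
  rw [fderiv_fun_sub hf hg]
  rfl

lemma pderiv_mul (hf : DifferentiableAt ℝ f x) (hg : DifferentiableAt ℝ g x) :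
    pderiv i (fun y => f y * g y) x = f x * pderiv i g x + g x * pderiv i f x := by
  simp only [pderiv]
  rw [fderiv_fun_mul hf hg]
  rfl

lemma pderiv_const_mul (c : ℝ) (hf : DifferentiableAt ℝ f x) :
    pderiv i (fun y => c * f y) x = c * pderiv i f x := by
  simp only [pderiv]
  rw [fderiv_const_mul hf]
  rfl

lemma pderiv_sum {ι : Type*} (s : Finset ι) {F : ι → EuclideanSpace ℝ (Fin n) → ℝ}
    (hF : ∀ j ∈ s, DifferentiableAt ℝ (F j) x) :
    pderiv i (fun y => ∑ j ∈ s, F j y) x = ∑ j ∈ s, pderiv i (F j) x := by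
  simp only [pderiv]
  rw [fderiv_fun_sum hF]
  simp

lemma pderiv_comp {h : ℝ → ℝ} {h' : ℝ} (hf : DifferentiableAt ℝ f x)
    (hh : HasDerivAt h h' (f x)) :
    pderiv i (fun y => h (f y)) x = h' * pderiv i f x := by
  have := (hh.comp_hasFDerivAt x hf.hasFDerivAt).fderiv
  simp only [pderiv]
  rw [show (fun y => h (f y)) = h ∘ f from rfl, this]
  rfl

lemma pderiv_comm (hf : ContDiff ℝ ∞ f) (i j : Fin n) (x : EuclideanSpace ℝ (Fin n)) :
    pderiv i (pderiv j f) x = pderiv j (pderiv i f) x := by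
  have hd : DifferentiableAt ℝ (fderiv ℝ f) x :=
    ((hf.fderiv_right (m := ∞) (by simp)).differentiable (by simp)) x
  have key : ∀ k l : Fin n, pderiv k (pderiv l f) x =
      fderiv ℝ (fderiv ℝ f) x (EuclideanSpace.single k 1) (EuclideanSpace.single l 1) := by
    intro k l
    have : pderiv l f = fun y => fderiv ℝ f y (EuclideanSpace.single l 1) := rfl
    rw [pderiv, this, fderiv_clm_apply hd (differentiableAt_const _)]
    simp
  rw [key, key]
  refine (hf.contDiffAt.isSymmSndFDerivAt ?_) _ _
  rw [minSmoothness_of_isRCLikeNormedField]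
  exact WithTop.coe_le_coe.2 (le_top (a := (2 : ℕ∞)))

lemma fderiv_eq_sum_pderiv (v : EuclideanSpace ℝ (Fin n)) :
    fderiv ℝ f x v = ∑ i, v i * pderiv i f x := by
  conv_lhs => rw [← (EuclideanSpace.basisFun (Fin n) ℝ).sum_repr v]
  simp [pderiv]

lemma hasDerivAt_line (hf : ContDiff ℝ ∞ f) (x : EuclideanSpace ℝ (Fin n)) (i : Fin n) (t : ℝ) :
    HasDerivAt (fun s : ℝ => f (x + s • EuclideanSpace.single i 1))
      (pderiv i f (x + t • EuclideanSpace.single i 1)) t := by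
  have h1 : HasDerivAt (fun s : ℝ => x + s • EuclideanSpace.single i (1 : ℝ))
      (EuclideanSpace.single i 1) t := by
    simpa using ((hasDerivAt_id t).smul_const (EuclideanSpace.single i (1 : ℝ))).const_add x
  exact (hf.differentiableAt_of_infty.hasFDerivAt).comp_hasDerivAt t h1

lemma pderiv_eq_zero_of_isMax (hx : ∀ y, f y ≤ f x) : pderiv i f x = 0 := by
  have : IsLocalMax f x := Filter.Eventually.of_forall hx
  simp [pderiv, this.fderiv_eq_zero]

lemma pderiv_pderiv_nonpos_of_isMax (hf : ContDiff ℝ ∞ f) (hx : ∀ y, f y ≤ f x) :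
    pderiv i (pderiv i f) x ≤ 0 := by
  by_contra! hpos
  set φ : ℝ → ℝ := fun s => f (x + s • EuclideanSpace.single i 1) with hφ
  have hd : deriv φ = fun t => pderiv i f (x + t • EuclideanSpace.single i 1) :=
    funext fun t => (hasDerivAt_line hf x i t).deriv
  have hdd : deriv (deriv φ) 0 = pderiv i (pderiv i f) x := by
    rw [hd, (hasDerivAt_line (hf.pderiv i) x i 0).deriv]
    simp
  have hmin : IsLocalMin φ 0 := by
    refine isLocalMin_of_deriv_deriv_pos (hdd ▸ hpos) ?_ (hasDerivAt_line hf x i 0).continuousAt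
    rw [hd]
    simpa using pderiv_eq_zero_of_isMax hx
  have hconst : φ =ᶠ[nhds 0] fun _ => φ 0 := by
    filter_upwards [hmin] with t ht
    refine le_antisymm ?_ ht
    simpa [hφ] using hx _
  have h0 : deriv (deriv φ) 0 = 0 := by
    rw [hconst.deriv.deriv_eq]
    simp
  linarith

lemma pderiv_pderiv_comp {h h₁ : ℝ → ℝ} {h₂ : ℝ} (hf : ContDiff ℝ ∞ f)
    (hh : ∀ y, HasDerivAt h (h₁ (f y)) (f y)) (hh₁ : HasDerivAt h₁ h₂ (f x)) :
    pderiv i (pderiv i fun y => h (f y)) x =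
      h₂ * pderiv i f x ^ 2 + h₁ (f x) * pderiv i (pderiv i f) x := by
  have e : (pderiv i fun y => h (f y)) = fun y => h₁ (f y) * pderiv i f y :=
    funext fun y => pderiv_comp hf.differentiableAt_of_infty (hh y)
  have hd := hh₁.differentiableAt.comp x (hf.differentiableAt_of_infty (x := x))
  rw [e, pderiv_mul (f := fun y => h₁ (f y)) hd (hf.pderiv i).differentiableAt_of_infty,
    pderiv_comp hf.differentiableAt_of_infty hh₁]
  ring

lemma gradSq_comp {h : ℝ → ℝ} {h' : ℝ} (hf : DifferentiableAt ℝ f x)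
    (hh : HasDerivAt h h' (f x)) :
    gradSq (fun y => h (f y)) x = h' ^ 2 * gradSq f x := by
  simp only [gradSq, pderiv_comp hf hh, Finset.mul_sum, mul_pow]

lemma driftLap_comp (V : EuclideanSpace ℝ (Fin n) → EuclideanSpace ℝ (Fin n))
    {h h₁ : ℝ → ℝ} {h₂ : ℝ} (hf : ContDiff ℝ ∞ f)
    (hh : ∀ y, HasDerivAt h (h₁ (f y)) (f y)) (hh₁ : HasDerivAt h₁ h₂ (f x)) :
    driftLap V (fun y => h (f y)) x = h₂ * gradSq f x + h₁ (f x) * driftLap V f x := by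
  simp only [driftLap, gradSq, Finset.mul_sum, ← Finset.sum_add_distrib]
  refine Finset.sum_congr rfl fun i _ => ?_
  rw [pderiv_pderiv_comp hf hh hh₁, pderiv_comp hf.differentiableAt_of_infty (hh x)]
  ring

lemma driftLap_eq (V : EuclideanSpace ℝ (Fin n) → EuclideanSpace ℝ (Fin n)) :
    driftLap V f x = lap f x + ⟪V x, gradient f x⟫ := by
  rw [real_inner_comm, gradient, InnerProductSpace.toDual_symm_apply, fderiv_eq_sum_pderiv,
    driftLap, Finset.sum_add_distrib]
  rfl

lemma gradient_apply (i : Fin n) : gradient f x i = pderiv i f x := by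
  have h : ⟪gradient f x, EuclideanSpace.single i (1 : ℝ)⟫ = pderiv i f x := by
    rw [gradient, InnerProductSpace.toDual_symm_apply]
    rfl
  rw [← h, EuclideanSpace.inner_single_right]
  simp

lemma pderiv_normSq (i : Fin n) :
    pderiv i (fun y : EuclideanSpace ℝ (Fin n) => ‖y‖ ^ 2) = fun y => 2 * y i := by
  funext y
  have h := ((hasStrictFDerivAt_norm_sq y).hasFDerivAt).fderiv
  simp only [pderiv]
  rw [h]
  simp [EuclideanSpace.inner_single_right]

lemma pderiv_pderiv_normSq (i : Fin n) (x : EuclideanSpace ℝ (Fin n)) :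
    pderiv i (pderiv i fun y : EuclideanSpace ℝ (Fin n) => ‖y‖ ^ 2) x = 2 := by
  rw [pderiv_normSq]
  have h : HasFDerivAt (fun y : EuclideanSpace ℝ (Fin n) => 2 * y i)
      ((2 : ℝ) • EuclideanSpace.proj i) x :=
    (EuclideanSpace.proj (𝕜 := ℝ) i).hasFDerivAt.const_mul 2
  rw [pderiv, h.fderiv]
  simp

lemma gradSq_normSq : gradSq (fun y : EuclideanSpace ℝ (Fin n) => ‖y‖ ^ 2) x = 4 * ‖x‖ ^ 2 := by
  simp only [gradSq, pderiv_normSq]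
  rw [EuclideanSpace.real_norm_sq_eq, Finset.mul_sum]
  exact Finset.sum_congr rfl fun i _ => by ring

lemma driftLap_normSq (V : EuclideanSpace ℝ (Fin n) → EuclideanSpace ℝ (Fin n)) :
    driftLap V (fun y => ‖y‖ ^ 2) x = 2 * n + 2 * ⟪V x, x⟫ := by
  simp only [driftLap, pderiv_pderiv_normSq, Finset.sum_add_distrib, PiLp.inner_apply,
    Finset.mul_sum]
  simp only [pderiv_normSq]
  simp [mul_comm, mul_assoc]

lemma inner_le_of_inner_fderiv_le {V : EuclideanSpace ℝ (Fin n) → EuclideanSpace ℝ (Fin n)}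
    (hV : ContDiff ℝ ∞ V) {K : ℝ} (hDV : ∀ x ξ, ⟪fderiv ℝ V x ξ, ξ⟫ ≤ K * ‖ξ‖ ^ 2)
    (x : EuclideanSpace ℝ (Fin n)) : ⟪V x, x⟫ ≤ ⟪V 0, x⟫ + K * ‖x‖ ^ 2 := by
  have hd : ∀ t : ℝ, HasDerivAt (fun s : ℝ => ⟪V (s • x), x⟫) ⟪fderiv ℝ V (t • x) x, x⟫ t := by
    intro t
    have h1 : HasDerivAt (fun s : ℝ => s • x) x t := by
      simpa using (hasDerivAt_id t).smul_const x
    have h2 := ((hV.differentiable (by simp)) (t • x)).hasFDerivAt.comp_hasDerivAt t h1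
    simpa using h2.inner ℝ (hasDerivAt_const t x)
  have := image_sub_le_mul_sub_of_deriv_le (fun t => (hd t).differentiableAt)
    (fun t => (hd t).deriv ▸ hDV (t • x) x) zero_le_one
  simp at this
  linarith

/-- The **Omori–Yau maximum principle** for the drift Laplacian. -/
lemma exists_almost_max {V : EuclideanSpace ℝ (Fin n) → EuclideanSpace ℝ (Fin n)}
    (hV : ContDiff ℝ ∞ V) {K : ℝ} (hK : 0 ≤ K)
    (hDV : ∀ x ξ, ⟪fderiv ℝ V x ξ, ξ⟫ ≤ K * ‖ξ‖ ^ 2)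
    (hf : ContDiff ℝ ∞ f) {M : ℝ} (hM : ∀ y, f y ≤ M) (x₀ : EuclideanSpace ℝ (Fin n))
    {ε : ℝ} (hε : 0 < ε) :
    ∃ x, f x₀ - ε ≤ f x ∧ gradSq f x ≤ ε ^ 2 ∧ driftLap V f x ≤ ε := by
  set ψ : EuclideanSpace ℝ (Fin n) → ℝ := fun y => Real.log (1 + ‖y‖ ^ 2) with hψ
  have hsq : ContDiff ℝ ∞ fun y : EuclideanSpace ℝ (Fin n) => ‖y‖ ^ 2 := contDiff_norm_sq ℝ
  have hψs : ContDiff ℝ ∞ ψ := by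
    refine ContDiff.log (contDiff_const.add hsq) fun y => ?_
    positivity
  have hψ0 : ∀ y, 0 ≤ ψ y := fun y => Real.log_nonneg (by nlinarith [sq_nonneg ‖y‖])
  have hlog : ∀ y : EuclideanSpace ℝ (Fin n),
      HasDerivAt (fun s : ℝ => Real.log (1 + s)) ((1 + ‖y‖ ^ 2)⁻¹) (‖y‖ ^ 2) := by
    intro y
    have h1 : HasDerivAt (fun s : ℝ => 1 + s) 1 (‖y‖ ^ 2) := (hasDerivAt_id _).const_add 1
    simpa using h1.log (by positivity)
  have hinv : ∀ y : EuclideanSpace ℝ (Fin n),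
      HasDerivAt (fun s : ℝ => (1 + s)⁻¹) (-1 / (1 + ‖y‖ ^ 2) ^ 2) (‖y‖ ^ 2) := by
    intro y
    have h1 : HasDerivAt (fun s : ℝ => 1 + s) 1 (‖y‖ ^ 2) := (hasDerivAt_id _).const_add 1
    exact h1.fun_inv (by positivity)
  have hψgrad : ∀ y, gradSq ψ y ≤ 1 := by
    intro y
    rw [hψ, gradSq_comp (h := fun s => Real.log (1 + s)) hsq.differentiableAt_of_infty (hlog y),
      gradSq_normSq, inv_pow, inv_mul_le_iff₀ (by positivity)]
    nlinarith [sq_nonneg (1 - ‖y‖ ^ 2)]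
  set C : ℝ := 2 * n + 2 * ‖V 0‖ + 2 * K with hC
  have hC0 : 0 ≤ C := by positivity
  have hψlap : ∀ y, driftLap V ψ y ≤ C := by
    intro y
    rw [hψ, driftLap_comp V (h := fun s => Real.log (1 + s)) (h₁ := fun s => (1 + s)⁻¹) hsq
      hlog (hinv y), gradSq_normSq, driftLap_normSq]
    have h1 : -1 / (1 + ‖y‖ ^ 2) ^ 2 * (4 * ‖y‖ ^ 2) ≤ 0 :=
      mul_nonpos_of_nonpos_of_nonneg
        (div_nonpos_of_nonpos_of_nonneg (by norm_num) (by positivity)) (by positivity)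
    have h2 : (1 + ‖y‖ ^ 2)⁻¹ * (2 * n + 2 * ⟪V y, y⟫) ≤ C := by
      rw [inv_mul_le_iff₀ (by positivity)]
      have h3 := inner_le_of_inner_fderiv_le hV hDV y
      have h4 := real_inner_le_norm (V 0) y
      have h5 : ‖V 0‖ * ‖y‖ ≤ ‖V 0‖ * (1 + ‖y‖ ^ 2) := by
        gcongr
        nlinarith [sq_nonneg (‖y‖ - 1)]
      have h6 : (0 : ℝ) ≤ n * ‖y‖ ^ 2 := by positivity
      rw [hC]
      nlinarith
    linarith
  set δ : ℝ := ε / (1 + C + ψ x₀) with hδ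
  have hden : 0 < 1 + C + ψ x₀ := by linarith [hψ0 x₀]
  have hδ0 : 0 < δ := by positivity
  have hδε : δ * (1 + C + ψ x₀) = ε := div_mul_cancel₀ _ hden.ne'
  have hsm : ContDiff ℝ ∞ fun y => f y - δ * ψ y := hf.sub (contDiff_const.mul hψs)
  have hψlim : Filter.Tendsto ψ (Filter.cocompact _) Filter.atTop := by
    refine Real.tendsto_log_atTop.comp (Filter.tendsto_atTop_add_const_left _ _ ?_)
    exact (Filter.tendsto_pow_atTop two_ne_zero).comp tendsto_norm_cocompact_atTop
  have hlim : Filter.Tendsto (fun y => f y - δ * ψ y) (Filter.cocompact _) Filter.atBot := by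
    refine Filter.tendsto_atBot_mono (fun y => ?_) (Filter.tendsto_atBot_add_const_left _ M
      (Filter.tendsto_neg_atTop_atBot.comp (hψlim.const_mul_atTop hδ0)))
    have := hM y
    simp only [Function.comp_apply]
    linarith
  obtain ⟨x, hx⟩ := hsm.continuous.exists_forall_ge hlim
  have hgrad : ∀ i, pderiv i f x = δ * pderiv i ψ x := by
    intro i
    have h := pderiv_eq_zero_of_isMax (i := i) hx
    rw [pderiv_sub hf.differentiableAt_of_infty
      (contDiff_const.mul hψs).differentiableAt_of_infty,
      pderiv_const_mul _ hψs.differentiableAt_of_infty] at h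
    linarith
  have hhess : ∀ i, pderiv i (pderiv i f) x ≤ δ * pderiv i (pderiv i ψ) x := by
    intro i
    have h := pderiv_pderiv_nonpos_of_isMax (i := i) hsm hx
    have e : (pderiv i fun y => f y - δ * ψ y) = fun y => pderiv i f y - δ * pderiv i ψ y := by
      funext y
      rw [pderiv_sub hf.differentiableAt_of_infty
        (contDiff_const.mul hψs).differentiableAt_of_infty,
        pderiv_const_mul _ hψs.differentiableAt_of_infty]
    rw [e, pderiv_sub (hf.pderiv i).differentiableAt_of_infty
      (contDiff_const.mul (hψs.pderiv i)).differentiableAt_of_infty,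
      pderiv_const_mul _ (hψs.pderiv i).differentiableAt_of_infty] at h
    linarith
  refine ⟨x, ?_, ?_, ?_⟩
  · have := hx x₀
    have h1 : 0 ≤ δ * ψ x := mul_nonneg hδ0.le (hψ0 x)
    nlinarith
  · have h1 : gradSq f x = δ ^ 2 * gradSq ψ x := by
      simp only [gradSq, hgrad, Finset.mul_sum, mul_pow]
    have h2 : δ ≤ ε := by nlinarith [mul_nonneg hδ0.le hC0, mul_nonneg hδ0.le (hψ0 x₀)]
    rw [h1]
    calc δ ^ 2 * gradSq ψ x ≤ δ ^ 2 * 1 := by gcongr; exact hψgrad x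
      _ ≤ ε ^ 2 := by rw [mul_one]; gcongr
  · have h1 : driftLap V f x ≤ δ * driftLap V ψ x := by
      simp only [driftLap, Finset.mul_sum]
      refine Finset.sum_le_sum fun i _ => ?_
      rw [hgrad i]
      nlinarith [hhess i]
    nlinarith [mul_le_mul_of_nonneg_left (hψlap x) hδ0.le, mul_nonneg hδ0.le (hψ0 x₀)]

/-- The **Bochner formula** for the drift Laplacian. -/
lemma driftLap_gradSq {V : EuclideanSpace ℝ (Fin n) → EuclideanSpace ℝ (Fin n)}
    (hV : ContDiff ℝ ∞ V) (hf : ContDiff ℝ ∞ f) (x : EuclideanSpace ℝ (Fin n)) :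
    driftLap V (gradSq f) x =
      2 * ∑ i, ∑ j, pderiv i (pderiv j f) x ^ 2
        + 2 * ∑ j, pderiv j f x * pderiv j (driftLap V f) x
        - 2 * ⟪fderiv ℝ V x (gradient f x), gradient f x⟫ := by
  have hVi : ∀ i, ContDiff ℝ ∞ fun y => V y i := fun i => (contDiff_euclidean.1 hV) i
  have d1 : ∀ i y, DifferentiableAt ℝ (pderiv i f) y := fun i y =>
    (hf.pderiv i).differentiableAt_of_infty
  have d2 : ∀ i j y, DifferentiableAt ℝ (pderiv i (pderiv j f)) y := fun i j y =>
    ((hf.pderiv j).pderiv i).differentiableAt_of_infty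
  have dV : ∀ i y, DifferentiableAt ℝ (fun y => V y i) y := fun i y =>
    (hVi i).differentiableAt_of_infty
  have e1 : ∀ i, pderiv i (gradSq f) =
      fun y => ∑ j, 2 * (pderiv j f y * pderiv i (pderiv j f) y) := by
    intro i
    funext y
    have : gradSq f = fun y => ∑ j, pderiv j f y * pderiv j f y := by
      funext z
      simp only [gradSq, sq]
    rw [this, pderiv_sum _ fun j _ => (d1 j y).fun_mul (d1 j y)]
    refine Finset.sum_congr rfl fun j _ => ?_
    rw [pderiv_mul (d1 j y) (d1 j y)]
    ring
  have e2 : ∀ i, pderiv i (pderiv i (gradSq f)) x = ∑ j, 2 * (pderiv i (pderiv j f) x ^ 2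
      + pderiv j f x * pderiv i (pderiv i (pderiv j f)) x) := by
    intro i
    rw [e1 i, pderiv_sum _ fun j _ => ((d1 j x).fun_mul (d2 i j x)).const_mul 2]
    refine Finset.sum_congr rfl fun j _ => ?_
    rw [pderiv_const_mul _ ((d1 j x).fun_mul (d2 i j x)), pderiv_mul (d1 j x) (d2 i j x)]
    ring
  have e3 : ∀ j, pderiv j (driftLap V f) x = ∑ i, (pderiv i (pderiv i (pderiv j f)) x
      + (V x i * pderiv i (pderiv j f) x + pderiv i f x * pderiv j (fun y => V y i) x)) := by
    intro j
    have : driftLap V f = fun y => ∑ i, (pderiv i (pderiv i f) y + V y i * pderiv i f y) := rfl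
    rw [this, pderiv_sum _ fun i _ => (d2 i i x).fun_add ((dV i x).fun_mul (d1 i x))]
    refine Finset.sum_congr rfl fun i _ => ?_
    have hc : pderiv j (pderiv i f) = pderiv i (pderiv j f) := funext (pderiv_comm hf j i)
    rw [pderiv_add (d2 i i x) ((dV i x).fun_mul (d1 i x)), pderiv_mul (dV i x) (d1 i x),
      pderiv_comm (hf.pderiv i) j i x, hc]
  have hDV : ∀ (v : EuclideanSpace ℝ (Fin n)) i,
      (fderiv ℝ V x v) i = ∑ j, v j * pderiv j (fun y => V y i) x := by
    intro v i
    rw [← fderiv_eq_sum_pderiv]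
    have h := ((EuclideanSpace.proj (𝕜 := ℝ) i).hasFDerivAt).comp x
      ((hV.differentiable (by simp)) x).hasFDerivAt
    have h' : HasFDerivAt (fun y => V y i)
      ((EuclideanSpace.proj (𝕜 := ℝ) i).comp (fderiv ℝ V x)) x := h
    rw [h'.fderiv]
    rfl
  have e4 : ⟪fderiv ℝ V x (gradient f x), gradient f x⟫ =
      ∑ i, ∑ j, pderiv j f x * (pderiv i f x * pderiv j (fun y => V y i) x) := by
    rw [PiLp.inner_apply]
    refine Finset.sum_congr rfl fun i _ => ?_
    simp only [hDV, gradient_apply, RCLike.inner_apply, conj_trivial, Finset.mul_sum]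
    refine Finset.sum_congr rfl fun j _ => ?_
    ring
  have e5 : ∑ j, pderiv j f x * pderiv j (driftLap V f) x = ∑ i, ∑ j, pderiv j f x *
      (pderiv i (pderiv i (pderiv j f)) x
        + (V x i * pderiv i (pderiv j f) x + pderiv i f x * pderiv j (fun y => V y i) x)) := by
    simp only [e3, Finset.mul_sum]
    exact Finset.sum_comm
  rw [e4, e5, driftLap]
  simp only [e2]
  simp only [e1, Finset.mul_sum, ← Finset.sum_add_distrib, ← Finset.sum_sub_distrib]
  refine Finset.sum_congr rfl fun i _ => Finset.sum_congr rfl fun j _ => ?_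
  ring

lemma sq_driftLap_le (V : EuclideanSpace ℝ (Fin n) → EuclideanSpace ℝ (Fin n))
    {N : ℝ} (hN : 0 < N) :
    driftLap V f x ^ 2 ≤ (n + N) * (∑ i, ∑ j, pderiv i (pderiv j f) x ^ 2
      + 1 / N * ⟪V x, gradient f x⟫ ^ 2) := by
  rw [driftLap_eq]
  set v := ⟪V x, gradient f x⟫
  set S := ∑ i, ∑ j, pderiv i (pderiv j f) x ^ 2
  have h1 : lap f x ^ 2 ≤ n * S := by
    have h2 : lap f x ^ 2 ≤ n * ∑ i, pderiv i (pderiv i f) x ^ 2 := by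
      have h3 := sq_sum_le_card_mul_sum_sq (s := Finset.univ)
        (f := fun i => pderiv i (pderiv i f) x)
      rwa [Finset.card_univ, Fintype.card_fin] at h3
    refine h2.trans (mul_le_mul_of_nonneg_left (Finset.sum_le_sum fun i _ => ?_) n.cast_nonneg)
    exact Finset.single_le_sum (f := fun j => pderiv i (pderiv j f) x ^ 2)
      (fun j _ => sq_nonneg _) (Finset.mem_univ i)
  have hS : 0 ≤ S := Finset.sum_nonneg fun _ _ => Finset.sum_nonneg fun _ _ => sq_nonneg _
  rcases (Nat.cast_nonneg (α := ℝ) n).eq_or_lt with h0 | hn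
  · have hl : lap f x = 0 := by
      rw [← h0, zero_mul] at h1
      nlinarith [sq_nonneg (lap f x)]
    have hv : N * (1 / N * v ^ 2) = v ^ 2 := by field_simp
    rw [hl, ← h0]
    nlinarith [mul_nonneg hN.le hS]
  · have h2 : lap f x ^ 2 / n ≤ S := by
      rw [div_le_iff₀ hn]
      linarith
    calc (lap f x + v) ^ 2
        ≤ (n + N) * (lap f x ^ 2 / n + 1 / N * v ^ 2) := by
          rw [← sub_nonneg]
          have : (n + N) * (lap f x ^ 2 / n + 1 / N * v ^ 2) - (lap f x + v) ^ 2
              = (N * lap f x - n * v) ^ 2 / (n * N) := by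
            field_simp
            ring
          rw [this]
          positivity
      _ ≤ _ := by gcongr

lemma normSq_gradient : ‖gradient f x‖ ^ 2 = gradSq f x := by
  rw [EuclideanSpace.real_norm_sq_eq, gradSq]
  simp only [gradient_apply]

lemma driftLap_log {V : EuclideanSpace ℝ (Fin n) → EuclideanSpace ℝ (Fin n)}
    (hf : ContDiff ℝ ∞ f) (hpos : ∀ y, 0 < f y) (x : EuclideanSpace ℝ (Fin n)) :
    driftLap V (fun y => Real.log (f y)) x =
      driftLap V f x / f x - gradSq (fun y => Real.log (f y)) x := by
  rw [driftLap_comp V (h₁ := fun s => s⁻¹) hf (fun y => Real.hasDerivAt_log (hpos y).ne')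
    (hasDerivAt_inv (hpos x).ne'),
    gradSq_comp hf.differentiableAt_of_infty (Real.hasDerivAt_log (hpos x).ne')]
  have := (hpos x).ne'
  field_simp
  ring

/-- If `p = |∇f|²` satisfies `Δ_V p + 2⟨∇f, ∇p⟩ ≥ c p²` with `c > 0`, then `p = 0`. The proof
applies `exists_almost_max` to `-(1 + p)^{-1/2}`. -/
lemma gradSq_eq_zero_of_le {V : EuclideanSpace ℝ (Fin n) → EuclideanSpace ℝ (Fin n)}
    (hV : ContDiff ℝ ∞ V) {K : ℝ} (hK : 0 ≤ K)
    (hDV : ∀ x ξ, ⟪fderiv ℝ V x ξ, ξ⟫ ≤ K * ‖ξ‖ ^ 2) (hf : ContDiff ℝ ∞ f) {c : ℝ} (hc : 0 < c)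
    (hle : ∀ y, c * gradSq f y ^ 2 ≤
      driftLap V (gradSq f) y + 2 * ∑ j, pderiv j f y * pderiv j (gradSq f) y)
    (x₀ : EuclideanSpace ℝ (Fin n)) : gradSq f x₀ = 0 := by
  by_contra hne
  have hp₀ : 0 < gradSq f x₀ := lt_of_le_of_ne gradSq_nonneg (Ne.symm hne)
  set m : EuclideanSpace ℝ (Fin n) → ℝ := fun y => √(1 + gradSq f y)
  have hpos : ∀ y, 0 < 1 + gradSq f y := fun y => by linarith [gradSq_nonneg (f := f) (x := y)]
  have hmsq : ∀ y, m y ^ 2 = 1 + gradSq f y := fun y => Real.sq_sqrt (hpos y).le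
  have hm1 : ∀ y, 1 ≤ m y := fun y =>
    Real.one_le_sqrt.2 (by linarith [gradSq_nonneg (f := f) (x := y)])
  have hm0 : ∀ y, 0 < m y := fun y => by linarith [hm1 y]
  have hsqrt : ∀ y, HasDerivAt (fun s : ℝ => √(1 + s)) (1 / (2 * m y)) (gradSq f y) := by
    intro y
    have h1 : HasDerivAt (fun s : ℝ => 1 + s) 1 (gradSq f y) := (hasDerivAt_id _).const_add 1
    exact h1.sqrt (hpos y).ne'
  set h₁ : ℝ → ℝ := fun s => 1 / 2 * (√(1 + s) ^ 3)⁻¹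
  have hd1 : ∀ y, HasDerivAt (fun s : ℝ => -(√(1 + s))⁻¹) (h₁ (gradSq f y)) (gradSq f y) := by
    intro y
    refine ((hsqrt y).fun_inv (hm0 y).ne').neg.congr_deriv ?_
    change -(-(1 / (2 * m y)) / m y ^ 2) = 1 / 2 * (m y ^ 3)⁻¹
    have := (hm0 y).ne'
    field_simp
  have hd2 : ∀ y, HasDerivAt h₁ (-3 / 4 * (m y ^ 5)⁻¹) (gradSq f y) := by
    intro y
    have hne3 : √(1 + gradSq f y) ^ 3 ≠ 0 := pow_ne_zero _ (hm0 y).ne'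
    refine ((((hsqrt y).fun_pow 3).fun_inv hne3).const_mul (1 / 2)).congr_deriv ?_
    change 1 / 2 * (-((3 : ℕ) * m y ^ (3 - 1) * (1 / (2 * m y))) / (m y ^ 3) ^ 2) =
      -3 / 4 * (m y ^ 5)⁻¹
    have := (hm0 y).ne'
    push_cast
    field_simp
    norm_num
  set g : EuclideanSpace ℝ (Fin n) → ℝ := fun y => -(√(1 + gradSq f y))⁻¹ with hg
  have hgs : ContDiff ℝ ∞ g :=
    (((contDiff_const.add hf.gradSq).sqrt fun y => (hpos y).ne').inv fun y => (hm0 y).ne').neg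
  have hg0 : ∀ y, g y ≤ 0 := fun y => neg_nonpos.2 (inv_nonneg.2 (hm0 y).le)
  have hm₀ : (m x₀)⁻¹ < 1 := by
    refine inv_lt_one_of_one_lt₀ ?_
    nlinarith [hmsq x₀, hm0 x₀]
  set θ : ℝ := (1 + (m x₀)⁻¹) / 2 with hθ
  have hθ1 : θ < 1 := by rw [hθ]; linarith
  have hθ0 : 0 < θ := by have := inv_pos.2 (hm0 x₀); rw [hθ]; linarith
  set κ : ℝ := 1 - θ ^ 2 with hκ
  have hκ0 : 0 < κ := by nlinarith
  obtain ⟨ε, hε0, hε⟩ : ∃ ε : ℝ, 0 < ε ∧ ε < min (min 1 (θ - (m x₀)⁻¹)) (c * κ ^ 2 / 12) := by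
    refine exists_between (lt_min (lt_min one_pos ?_) (by positivity))
    rw [hθ]
    linarith
  simp only [lt_min_iff] at hε
  obtain ⟨⟨hε1, hεθ⟩, hεc⟩ := hε
  obtain ⟨x, hgx, hgrad, hlap⟩ := exists_almost_max hV hK hDV hgs hg0 x₀ hε0
  have hminv : (m x)⁻¹ ≤ θ := by
    change -(m x₀)⁻¹ - ε ≤ -(m x)⁻¹ at hgx
    linarith
  have hp : m x ^ 2 * κ ≤ gradSq f x := by
    have h1 : 1 ≤ θ * m x := by
      rwa [inv_le_iff_one_le_mul₀ (hm0 x)] at hminv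
    have h2 : 1 ≤ (θ * m x) ^ 2 := one_le_pow₀ h1
    rw [hκ]
    nlinarith [hmsq x]
  have hgg : gradSq g x = (h₁ (gradSq f x)) ^ 2 * gradSq (gradSq f) x :=
    gradSq_comp hf.gradSq.differentiableAt_of_infty (hd1 x)
  have hgl : driftLap V g x = -3 / 4 * (m x ^ 5)⁻¹ * gradSq (gradSq f) x
      + h₁ (gradSq f x) * driftLap V (gradSq f) x :=
    driftLap_comp V hf.gradSq hd1 (hd2 x)
  have hh₁x : h₁ (gradSq f x) = 1 / 2 * (m x ^ 3)⁻¹ := rfl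
  have hcross : h₁ (gradSq f x) * ∑ j, pderiv j f x * pderiv j (gradSq f) x
      = ∑ j, pderiv j f x * pderiv j g x := by
    rw [Finset.mul_sum]
    refine Finset.sum_congr rfl fun j _ => ?_
    rw [hg, pderiv_comp (h := fun s => -(√(1 + s))⁻¹) hf.gradSq.differentiableAt_of_infty (hd1 x)]
    ring
  have hCS : ∑ j, pderiv j f x * pderiv j g x ≤ m x * ε := by
    refine abs_le_of_sq_le_sq' ?_ (by have := hm0 x; positivity) |>.2
    calc (∑ j, pderiv j f x * pderiv j g x) ^ 2 ≤ gradSq f x * gradSq g x :=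
          Finset.sum_mul_sq_le_sq_mul_sq _ _ _
      _ ≤ m x ^ 2 * ε ^ 2 := by
          refine mul_le_mul ?_ hgrad gradSq_nonneg (sq_nonneg _)
          linarith [hmsq x]
      _ = (m x * ε) ^ 2 := by ring
  have hquad : -3 / 4 * (m x ^ 5)⁻¹ * gradSq (gradSq f) x = -(3 * m x * gradSq g x) := by
    rw [hgg, hh₁x]
    have := (hm0 x).ne'
    field_simp
    ring
  have hmain : c / 2 * κ ^ 2 * m x ≤ h₁ (gradSq f x) * (c * gradSq f x ^ 2) := by
    rw [hh₁x]
    have hmx := hm0 x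
    calc c / 2 * κ ^ 2 * m x = 1 / 2 * (m x ^ 3)⁻¹ * (c * (m x ^ 2 * κ) ^ 2) := by
          field_simp
      _ ≤ _ := by gcongr
  have hh₁pos : 0 ≤ h₁ (gradSq f x) := by
    rw [hh₁x]
    have := hm0 x
    positivity
  have h3 := mul_le_mul_of_nonneg_left (hle x) hh₁pos
  rw [mul_add, mul_left_comm _ (2 : ℝ), hcross] at h3
  rw [hgl, hquad] at hlap
  have h4 : m x * gradSq g x ≤ m x * ε := by
    refine mul_le_mul_of_nonneg_left (hgrad.trans ?_) (hm0 x).le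
    exact pow_le_of_le_one hε0.le hε1.le two_ne_zero
  have h5 : c / 2 * κ ^ 2 * m x ≤ 6 * ε * m x := by
    have h7 : ε ≤ ε * m x := le_mul_of_one_le_right hε0.le (hm1 x)
    linarith
  have h6 := le_of_mul_le_mul_right h5 (hm0 x)
  linarith

end Auxiliary

/-- **Liouville-type theorem** (Euclidean instance of Corollary 3.3): under the
`Ric_V^N ≥ -K` condition, if `a, b < 0` are constants with `a ≤ -K` and `u` is a smooth
positive solution of `Δu + ⟨V, ∇u⟩ + a u log u + b u = 0` with `u ≤ 1`, then
`u ≡ e^{-b/a}`. -/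
theorem liouville_general_elliptic {n : ℕ} (N : ℕ) (hN : 0 < N)
    (V : EuclideanSpace ℝ (Fin n) → EuclideanSpace ℝ (Fin n)) (hV : ContDiff ℝ ∞ V)
    (K : ℝ) (hK : 0 ≤ K)
    (hRic : ∀ x ξ : EuclideanSpace ℝ (Fin n),
      (1 / 2) * (⟪fderiv ℝ V x ξ, ξ⟫ + ⟪ξ, fderiv ℝ V x ξ⟫)
        + (1 / (N : ℝ)) * ⟪V x, ξ⟫ ^ 2 ≤ K * ‖ξ‖ ^ 2)
    (a b : ℝ) (ha : a < 0) (hb : b < 0) (haK : a ≤ -K)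
    (u : EuclideanSpace ℝ (Fin n) → ℝ) (hu_smooth : ContDiff ℝ ∞ u)
    (hu_pos : ∀ x, 0 < u x) (hu_le : ∀ x, u x ≤ 1)
    (heq : ∀ x, lap u x + ⟪V x, gradient u x⟫
      + a * u x * Real.log (u x) + b * u x = 0) :
    ∀ x, u x = Real.exp (-b / a) := by
  have hN' : (0 : ℝ) < N := Nat.cast_pos.2 hN
  have hRic' : ∀ x ξ, ⟪fderiv ℝ V x ξ, ξ⟫ + 1 / (N : ℝ) * ⟪V x, ξ⟫ ^ 2 ≤ K * ‖ξ‖ ^ 2 := by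
    intro x ξ
    have h := hRic x ξ
    rw [real_inner_comm (fderiv ℝ V x ξ) ξ] at h
    linarith
  have hDV : ∀ x ξ, ⟪fderiv ℝ V x ξ, ξ⟫ ≤ K * ‖ξ‖ ^ 2 := by
    intro x ξ
    have h : 0 ≤ 1 / (N : ℝ) * ⟪V x, ξ⟫ ^ 2 := by positivity
    linarith [hRic' x ξ]
  set f : EuclideanSpace ℝ (Fin n) → ℝ := fun y => Real.log (u y) with hf_def
  have hf : ContDiff ℝ ∞ f := hu_smooth.log fun y => (hu_pos y).ne'
  have hf0 : ∀ y, f y ≤ 0 := fun y => Real.log_nonpos (hu_pos y).le (hu_le y)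
  have hfeq : ∀ y, driftLap V f y = -a * f y - b - gradSq f y := by
    intro y
    have h1 : driftLap V u y = u y * (-a * f y - b) := by
      rw [driftLap_eq]
      have := heq y
      simp only [hf_def]
      linarith
    rw [hf_def, driftLap_log hu_smooth hu_pos, h1, mul_div_cancel_left₀ _ (hu_pos y).ne']
  have hupper : ∀ y, -a * f y - b ≤ 0 := by
    intro y
    by_contra! hpos
    set η := -a * f y - b with hη
    have hden : 0 < 2 - a := by linarith
    obtain ⟨ε, hε0, hε⟩ : ∃ ε : ℝ, 0 < ε ∧ ε < min 1 (η / (2 - a)) :=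
      exists_between (lt_min one_pos (div_pos hpos hden))
    rw [lt_min_iff, lt_div_iff₀ hden] at hε
    obtain ⟨x, h1, h2, h3⟩ := exists_almost_max hV hK hDV hf hf0 y hε0
    rw [hfeq] at h3
    nlinarith
  have hBochner : ∀ y, 2 / (n + N : ℝ) * gradSq f y ^ 2 ≤
      driftLap V (gradSq f) y + 2 * ∑ j, pderiv j f y * pderiv j (gradSq f) y := by
    intro y
    have hpd : ∀ j, pderiv j (driftLap V f) y = -a * pderiv j f y - pderiv j (gradSq f) y := by
      intro j
      have hl : DifferentiableAt ℝ (fun z => -a * f z + -b) y :=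
        ((contDiff_const.mul hf).add contDiff_const).differentiableAt_of_infty
      rw [funext hfeq, pderiv_sub (f := fun z => -a * f z - b) (by simpa [sub_eq_add_neg] using hl)
        hf.gradSq.differentiableAt_of_infty,
        pderiv_comp (h := fun s => -a * s - b) (h' := -a) hf.differentiableAt_of_infty]
      simpa using ((hasDerivAt_id (f y)).const_mul (-a)).sub_const b
    have hsum : ∑ j, pderiv j f y * pderiv j (driftLap V f) y =
        -a * gradSq f y - ∑ j, pderiv j f y * pderiv j (gradSq f) y := by
      simp only [hpd, gradSq, Finset.mul_sum, ← Finset.sum_sub_distrib]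
      exact Finset.sum_congr rfl fun j _ => by ring
    have h1 := hRic' y (gradient f y)
    rw [normSq_gradient] at h1
    have h2 := sq_driftLap_le (f := f) (x := y) V hN'
    have h3 : gradSq f y ^ 2 ≤ driftLap V f y ^ 2 := by
      have := hupper y
      have := gradSq_nonneg (f := f) (x := y)
      rw [hfeq]
      nlinarith
    have h4 : 0 ≤ (-a - K) * gradSq f y := mul_nonneg (by linarith) gradSq_nonneg
    rw [driftLap_gradSq hV hf, hsum, div_mul_eq_mul_div, div_le_iff₀ (by positivity)]
    have h5 : (0 : ℝ) < n + N := by positivity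
    nlinarith
  intro x
  have hzero : ∀ y, gradSq f y = 0 :=
    gradSq_eq_zero_of_le hV hK hDV hf (by positivity) hBochner
  have hpz : ∀ i, pderiv i f = fun _ => 0 := by
    intro i
    funext y
    have h := (Finset.sum_eq_zero_iff_of_nonneg fun j _ => sq_nonneg (pderiv j f y)).1 (hzero y)
    exact pow_eq_zero_iff two_ne_zero |>.1 (h i (Finset.mem_univ i))
  have hlapz : driftLap V f x = 0 := by
    simp only [driftLap, hpz]
    simp [pderiv]
  have hfx := hfeq x
  rw [hlapz, hzero x] at hfx
  have hval : Real.log (u x) = -b / a := by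
    rw [eq_div_iff ha.ne]
    change f x * a = -b
    linarith
  rw [← hval, Real.exp_log (hu_pos x)]
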